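/- arXiv:2112.14430 — 4 statements merged into one kernel-verified Lean document; each statement's English description precedes it below -/
import Mathlib

section
/- Let Ω and Ω' be measurable spaces, let μ and ν be probability measures on Ω, let κ be a Markov kernel from Ω to Ω', and let ε ≥ 0 and δ ≥ 0 be real numbers. If for every measurable set Y ⊆ Ω one has μ(Y) ≤ exp(ε)·ν(Y) + δ, then for every measurable set Z ⊆ Ω' one has (μ.bind κ)(Z) ≤ exp(ε)·(ν.bind κ)(Z) + δ. (Differential privacy is immune to post-processing by randomized algorithms, e.g., an off-the-shelf stochastic optimizer applied after a private forward computation.) -/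
open MeasureTheory ProbabilityTheory

/-- Differential privacy is immune to post-processing by randomized algorithms
(Markov kernels): if `(μ, ν)` satisfies the `(ε, δ)`-DP inequality, then so does
`(μ.bind κ, ν.bind κ)`. -/
theorem dp_postprocessing_kernel
    {Ω Ω' : Type*} [MeasurableSpace Ω] [MeasurableSpace Ω']
    (μ ν : Measure Ω) [IsProbabilityMeasure μ] [IsProbabilityMeasure ν]
    (κ : Kernel Ω Ω') [IsMarkovKernel κ]
    (ε δ : ℝ) (hε : 0 ≤ ε) (hδ : 0 ≤ δ)
    (hdp : ∀ Y : Set Ω, MeasurableSet Y →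
      μ Y ≤ ENNReal.ofReal (Real.exp ε) * ν Y + ENNReal.ofReal δ) :
    ∀ Z : Set Ω', MeasurableSet Z →
      (μ.bind fun ω => κ ω) Z ≤
        ENNReal.ofReal (Real.exp ε) * (ν.bind fun ω => κ ω) Z + ENNReal.ofReal δ := by
  intro Z hZ
  have hm : Measurable fun ω => (κ ω Z) := κ.measurable_coe hZ
  have hmr : Measurable fun ω => (κ ω Z).toReal := hm.ennreal_toReal
  have hle : ∀ ω, (κ ω Z).toReal ≤ 1 := fun ω =>
    ENNReal.toReal_le_of_le_ofReal zero_le_one (by simpa using prob_le_one)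
  have key : ∀ ρ : Measure Ω, (ρ.bind fun ω => κ ω) Z
      = ∫⁻ t in Set.Ioi (0 : ℝ), ρ {ω | t ≤ (κ ω Z).toReal} := by
    intro ρ
    rw [Measure.bind_apply hZ κ.measurable.aemeasurable,
      ← lintegral_eq_lintegral_meas_le ρ
        (Filter.Eventually.of_forall fun ω => ENNReal.toReal_nonneg) hmr.aemeasurable]
    refine lintegral_congr fun ω => ?_
    rw [ENNReal.ofReal_toReal (measure_ne_top _ _)]
  rw [key μ, key ν]
  have hd : ∫⁻ t in Set.Ioi (0 : ℝ), (Set.Iic (1 : ℝ)).indicator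
      (fun _ => ENNReal.ofReal δ) t = ENNReal.ofReal δ := by
    rw [lintegral_indicator_const measurableSet_Iic,
      Measure.restrict_apply measurableSet_Iic, Set.inter_comm, Set.Ioi_inter_Iic]
    simp
  rw [← lintegral_const_mul' _ _ ENNReal.ofReal_ne_top]
  refine le_trans ?_ (le_of_eq (congrArg _ hd))
  rw [← lintegral_add_right _ (measurable_const.indicator measurableSet_Iic)]
  refine lintegral_mono fun t => ?_
  by_cases ht : t ≤ 1
  · simpa [Set.indicator, ht] using hdp _ (measurableSet_le measurable_const hmr)
  · have : {ω | t ≤ (κ ω Z).toReal} = ∅ := by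
      ext ω
      simp only [Set.mem_setOf_eq, Set.mem_empty_iff_false, iff_false]
      exact fun h => ht (h.trans (hle ω))
    simp [this]
end

section
/- Let M ≥ 1 be a real number and let y > 0. Then y² ≤ log(1 + M·(exp(y²) − 1)) ≤ M·y². Consequently, if C > 0 and σ, σ̃ > 0 satisfy the exact calibration identity exp((C/σ)²) − 1 = M·(exp((C/σ̃)²) − 1), then σ̃²/M ≤ σ² ≤ σ̃². (The per-coordinate noise power of DP-FP with M micro-batches lies between 1/M times and one times the DP-SGD noise power at the same privacy budget, clipping threshold, number of steps, and expected batch size.) -/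
/-- For `M ≥ 1` and `y > 0`, `y² ≤ log(1 + M·(exp(y²) − 1)) ≤ M·y²`.  Consequently, under
the exact calibration identity `exp((C/σ)²) − 1 = M·(exp((C/σ̃)²) − 1)`, the DP-FP
per-coordinate noise power satisfies `σ̃²/M ≤ σ² ≤ σ̃²`. -/
theorem dpfp_noise_power_bounds (M : ℝ) (hM : 1 ≤ M) :
    (∀ y : ℝ, 0 < y →
      y ^ 2 ≤ Real.log (1 + M * (Real.exp (y ^ 2) - 1)) ∧
      Real.log (1 + M * (Real.exp (y ^ 2) - 1)) ≤ M * y ^ 2) ∧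
    (∀ C σ σt : ℝ, 0 < C → 0 < σ → 0 < σt →
      Real.exp ((C / σ) ^ 2) - 1 = M * (Real.exp ((C / σt) ^ 2) - 1) →
      σt ^ 2 / M ≤ σ ^ 2 ∧ σ ^ 2 ≤ σt ^ 2) := by
  have key : ∀ y : ℝ, 0 < y →
      y ^ 2 ≤ Real.log (1 + M * (Real.exp (y ^ 2) - 1)) ∧
      Real.log (1 + M * (Real.exp (y ^ 2) - 1)) ≤ M * y ^ 2 := by
    intro y hy
    have h1 : 0 ≤ Real.exp (y ^ 2) - 1 := by
      have := Real.one_le_exp (sq_nonneg y)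
      linarith
    have hpos : 0 < 1 + M * (Real.exp (y ^ 2) - 1) := by positivity
    constructor
    · rw [Real.le_log_iff_exp_le hpos]
      nlinarith
    · rw [Real.log_le_iff_le_exp hpos]
      have hb := one_add_mul_self_le_rpow_one_add (s := Real.exp (y ^ 2) - 1) (by linarith) hM
      rw [add_sub_cancel, ← Real.exp_mul] at hb
      rwa [mul_comm M (y ^ 2)]
  refine ⟨key, ?_⟩
  intro C σ σt hC hσ hσt h
  obtain ⟨ha, hb⟩ := key (C / σt) (by positivity)
  rw [← h, add_sub_cancel, Real.log_exp, div_pow, div_pow] at ha hb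
  have hM0 : 0 < M := by linarith
  have hC2 : 0 < C ^ 2 := by positivity
  have hs : 0 < σ ^ 2 := by positivity
  have ht : 0 < σt ^ 2 := by positivity
  constructor
  · rw [← mul_div_assoc, div_le_div_iff₀ hs ht] at hb
    rw [div_le_iff₀ hM0]
    refine le_of_mul_le_mul_left ?_ hC2
    linarith
  · rw [div_le_div_iff₀ ht hs] at ha
    exact le_of_mul_le_mul_left ha hC2
end

section
/- Let M > 0 be a real number. Then the limit as y → 0⁺ of y² / log(1 + M·(exp(y²) − 1)) equals 1/M. Consequently, if C > 0 is fixed and for each σ̃ > 0 one defines σ(σ̃) > 0 by the exact calibration identity exp((C/σ(σ̃))²) − 1 = M·(exp((C/σ̃)²) − 1), then σ(σ̃)²/σ̃² → 1/M as σ̃ → ∞. (In the strong differential-privacy regime, DP-FP with M micro-batches requires 1/M times the per-coordinate noise power of DP-SGD at the same privacy budget, clipping threshold, number of steps, and expected batch size.) -/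
open Filter Topology

/-- In the strong DP regime, `y² / log(1 + M·(exp(y²) − 1)) → 1/M` as `y → 0⁺`.
Consequently, if `σ(σ̃)` is calibrated via `exp((C/σ(σ̃))²) − 1 = M·(exp((C/σ̃)²) − 1)`,
then `σ(σ̃)²/σ̃² → 1/M` as `σ̃ → ∞`: DP-FP with `M` micro-batches requires `1/M` times the
per-coordinate noise power of DP-SGD. -/
theorem dpfp_noise_power_ratio_limit (M : ℝ) (hM : 0 < M) :
    Tendsto (fun y : ℝ => y ^ 2 / Real.log (1 + M * (Real.exp (y ^ 2) - 1)))
      (𝓝[>] 0) (𝓝 (1 / M)) ∧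
    (∀ C : ℝ, 0 < C → ∀ σ : ℝ → ℝ,
      (∀ σt : ℝ, 0 < σt → 0 < σ σt ∧
        Real.exp ((C / σ σt) ^ 2) - 1 = M * (Real.exp ((C / σt) ^ 2) - 1)) →
      Tendsto (fun σt : ℝ => (σ σt) ^ 2 / σt ^ 2) atTop (𝓝 (1 / M))) := by
  have h1 : Tendsto (fun y : ℝ => y ^ 2 / Real.log (1 + M * (Real.exp (y ^ 2) - 1)))
      (𝓝[>] 0) (𝓝 (1 / M)) := by
    have hd : HasDerivAt (fun x : ℝ => Real.log (1 + M * (Real.exp x - 1))) M 0 := by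
      have h := (((Real.hasDerivAt_exp 0).sub_const 1).const_mul M).const_add 1
      have h' := h.log (by simp)
      simpa using h'
    have hs := hasDerivAt_iff_tendsto_slope_zero.1 hd
    have hy : Tendsto (fun y : ℝ => y ^ 2) (𝓝[>] 0) (𝓝[≠] 0) := by
      refine tendsto_nhdsWithin_iff.2 ⟨?_, ?_⟩
      · have : Tendsto (fun y : ℝ => y ^ 2) (𝓝 0) (𝓝 0) := by
          simpa using (continuous_pow 2 : Continuous fun y : ℝ => y ^ 2).tendsto 0
        exact this.mono_left nhdsWithin_le_nhds
      · filter_upwards [self_mem_nhdsWithin] with y hy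
        have hy' : (0 : ℝ) < y := hy
        exact (pow_pos hy' 2).ne'
    have h := (hs.comp hy).inv₀ hM.ne'
    rw [one_div]
    refine h.congr fun y => ?_
    simp [div_eq_mul_inv, mul_comm]
  refine ⟨h1, fun C hC σ hσ => ?_⟩
  have hy : Tendsto (fun s : ℝ => C / s) atTop (𝓝[>] 0) := by
    refine tendsto_nhdsWithin_iff.2 ⟨tendsto_const_nhds.div_atTop tendsto_id, ?_⟩
    filter_upwards [eventually_gt_atTop 0] with s hs
    exact div_pos hC hs
  refine (h1.comp hy).congr' ?_
  filter_upwards [eventually_gt_atTop 0] with s hs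
  obtain ⟨hp, he⟩ := hσ s hs
  simp only [Function.comp]
  rw [← he, add_sub_cancel, Real.log_exp]
  field_simp
end

section
/- Let c, c′ ∈ ℝ, let σ > 0 with c ≠ c′, set μ = |c − c′|/σ, and let ε ≥ 0. Then for every measurable set Y ⊆ ℝ, 𝒩(c, σ²)(Y) ≤ exp(ε)·𝒩(c′, σ²)(Y) + δ(ε; μ), where δ(ε; μ) = Φ(−ε/μ + μ/2) − exp(ε)·Φ(−ε/μ − μ/2) and Φ is the cumulative distribution function of the standard normal distribution 𝒩(0, 1). (The Gaussian mechanism with noise standard deviation σ applied to a function of ℓ₂-sensitivity |c − c′| is (ε, δ(ε; μ))-differentially private, with the exact privacy profile of Balle and Wang.) -/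
open MeasureTheory ProbabilityTheory

/-- `Φ`, the cumulative distribution function of the standard normal distribution. -/
noncomputable def stdNormalCDF (t : ℝ) : ℝ :=
  ((gaussianReal 0 1) (Set.Iic t)).toReal


lemma gpp_pdf_compare (m x : ℝ) (k : ℝ) (hk : k = m * x - m ^ 2 / 2) :
    gaussianPDFReal m 1 x = Real.exp k * gaussianPDFReal 0 1 x := by
  simp only [gaussianPDFReal, NNReal.coe_one]
  rw [mul_left_comm, ← Real.exp_add]
  congr 2
  rw [hk]; ring

lemma gpp_core (m ε : ℝ) (hm : 0 < m) (A : Set ℝ) (hA : MeasurableSet A) :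
    (gaussianReal 0 1).real A + Real.exp ε * (gaussianReal m 1).real (Set.Iic (-ε / m + m / 2)) ≤
      (gaussianReal 0 1).real (Set.Iic (-ε / m + m / 2)) +
        Real.exp ε * (gaussianReal m 1).real A := by
  set t := -ε / m + m / 2 with ht
  have hmt : m * t = -ε + m ^ 2 / 2 := by rw [ht]; field_simp
  have hB : MeasurableSet (Set.Iic t) := measurableSet_Iic
  have key : ∀ x, Real.exp ε * gaussianPDFReal m 1 x
      = Real.exp (m * (x - t)) * gaussianPDFReal 0 1 x := by
    intro x
    rw [gpp_pdf_compare m x _ rfl, ← mul_assoc, ← Real.exp_add]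
    congr 2
    linarith
  have hreal : ∀ (a : ℝ) (s : Set ℝ), (gaussianReal a 1).real s = ∫ x in s, gaussianPDFReal a 1 x := by
    intro a s
    rw [Measure.real, gaussianReal_apply_eq_integral _ one_ne_zero,
      ENNReal.toReal_ofReal (integral_nonneg fun x => gaussianPDFReal_nonneg _ _ _)]
  have h1 : (gaussianReal 0 1).real (A \ Set.Iic t) ≤
      Real.exp ε * (gaussianReal m 1).real (A \ Set.Iic t) := by
    rw [hreal, hreal, ← integral_const_mul]
    refine setIntegral_mono_on (integrable_gaussianPDFReal _ _).integrableOn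
      ((integrable_gaussianPDFReal _ _).const_mul _).integrableOn (hA.diff hB) ?_
    intro x hx
    rw [key]
    have : t < x := by simpa using hx.2
    exact le_mul_of_one_le_left (gaussianPDFReal_nonneg _ _ _)
      (Real.one_le_exp (by nlinarith))
  have h2 : Real.exp ε * (gaussianReal m 1).real (Set.Iic t \ A) ≤
      (gaussianReal 0 1).real (Set.Iic t \ A) := by
    rw [hreal, hreal, ← integral_const_mul]
    refine setIntegral_mono_on ((integrable_gaussianPDFReal _ _).const_mul _).integrableOn
      (integrable_gaussianPDFReal _ _).integrableOn (hB.diff hA) ?_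
    intro x hx
    rw [key]
    have : x ≤ t := hx.1
    exact mul_le_of_le_one_left (gaussianPDFReal_nonneg _ _ _)
      (Real.exp_le_one_iff.2 (by nlinarith))
  have e1 := measureReal_inter_add_sdiff (μ := gaussianReal 0 1) (s := A) hB
  have e2 := measureReal_inter_add_sdiff (μ := gaussianReal m 1) (s := A) hB
  have e3 := measureReal_inter_add_sdiff (μ := gaussianReal 0 1) (s := (Set.Iic t)) hA
  have e4 := measureReal_inter_add_sdiff (μ := gaussianReal m 1) (s := (Set.Iic t)) hA
  rw [Set.inter_comm] at e3 e4
  have e5 := congrArg (Real.exp ε * ·) e2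
  have e6 := congrArg (Real.exp ε * ·) e4
  simp only [mul_add] at e5 e6
  linarith

lemma gpp_shift (m t : ℝ) :
    (gaussianReal m 1).real (Set.Iic (t + m)) = stdNormalCDF t := by
  have h := gaussianReal_map_add_const (μ := 0) (v := 1) m
  rw [zero_add] at h
  rw [← h, Measure.real, Measure.map_apply (by fun_prop) measurableSet_Iic, stdNormalCDF]
  congr 2
  ext x; simp

lemma gpp_std (m ε : ℝ) (hm : 0 < m) (A : Set ℝ) (hA : MeasurableSet A) :
    gaussianReal 0 1 A ≤ ENNReal.ofReal (Real.exp ε) * gaussianReal m 1 A +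
      ENNReal.ofReal
        (stdNormalCDF (-ε / m + m / 2) - Real.exp ε * stdNormalCDF (-ε / m - m / 2)) := by
  have h := gpp_core m ε hm A hA
  have hs := gpp_shift m (-ε / m - m / 2)
  rw [show -ε / m - m / 2 + m = -ε / m + m / 2 by ring] at hs
  rw [hs] at h
  change _ ≤ stdNormalCDF (-ε / m + m / 2) + _ at h
  rw [← ofReal_measureReal (μ := gaussianReal 0 1), ← ofReal_measureReal (μ := gaussianReal m 1),
    ← ENNReal.ofReal_mul (Real.exp_pos _).le]
  refine (ENNReal.ofReal_le_ofReal ?_).trans ENNReal.ofReal_add_le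
  linarith

lemma gpp_map (c a m : ℝ) (v : NNReal) (hv : (v : ℝ) = a ^ 2) :
    (gaussianReal m 1).map (fun x => c + a * x) = gaussianReal (c + a * m) v := by
  have : (fun x : ℝ => c + a * x) = (fun x => c + x) ∘ (fun x => a * x) := rfl
  rw [this, ← Measure.map_map (by fun_prop) (by fun_prop), gaussianReal_map_const_mul,
    gaussianReal_map_const_add]
  congr 1
  · ring
  · ext; simp [hv]

/-- The Gaussian mechanism with noise standard deviation `σ` applied to a function with
ℓ₂-sensitivity `|c − c′|` is `(ε, δ(ε; μ))`-differentially private, where `μ = |c − c′|/σ`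
and `δ(ε; μ) = Φ(−ε/μ + μ/2) − exp(ε)·Φ(−ε/μ − μ/2)` is the exact privacy profile of
Balle and Wang. -/
theorem gaussian_mechanism_privacy_profile
    (c c' σ : ℝ) (hσ : 0 < σ) (hne : c ≠ c') (μ : ℝ) (hμ : μ = |c - c'| / σ)
    (ε : ℝ) (hε : 0 ≤ ε) :
    ∀ Y : Set ℝ, MeasurableSet Y →
      (gaussianReal c ⟨σ ^ 2, sq_nonneg σ⟩) Y ≤
        ENNReal.ofReal (Real.exp ε) * (gaussianReal c' ⟨σ ^ 2, sq_nonneg σ⟩) Y +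
          ENNReal.ofReal
            (stdNormalCDF (-ε / μ + μ / 2) - Real.exp ε * stdNormalCDF (-ε / μ - μ / 2)) := by
  intro Y hY
  have hcc : 0 < |c - c'| := abs_pos.2 (sub_ne_zero.2 hne)
  have hm : 0 < μ := by rw [hμ]; positivity
  obtain ⟨a, ha2, ham⟩ : ∃ a : ℝ, a ^ 2 = σ ^ 2 ∧ c + a * μ = c' := by
    have hσμ : σ * μ = |c - c'| := by rw [hμ]; field_simp
    rcases abs_cases (c - c') with h | h
    · exact ⟨-σ, by ring, by linarith⟩
    · exact ⟨σ, by ring, by linarith⟩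
  have m1 := gpp_map c a 0 ⟨σ ^ 2, sq_nonneg σ⟩ ha2.symm
  have m2 := gpp_map c a μ ⟨σ ^ 2, sq_nonneg σ⟩ ha2.symm
  rw [mul_zero, add_zero] at m1
  rw [ham] at m2
  have hf : Measurable (fun x : ℝ => c + a * x) := by fun_prop
  rw [← m1, ← m2, Measure.map_apply hf hY, Measure.map_apply hf hY]
  exact gpp_std μ ε hm _ (hf hY)
end
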